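/- Let A = A₀ ⊕ A₁ ⊕ ⋯ ⊕ A_{F-1} be a ℤ/F-graded associative ℂ-algebra. Fix i ∈ {1,…,F-1} and define: [a₀,a₀'] = a₀a₀' - a₀'a₀ for a₀,a₀' ∈ A₀; [a₀,a₁] = a₀a₁ - a₁a₀ for a₀ ∈ A₀, a₁ ∈ A_i; and {a₁,…,a_F} = Σ_{σ ∈ S_F} a_{σ(1)}⋯a_{σ(F)} for a₁,…,a_F ∈ A_i. Then these brackets satisfy all four Jacobi identities of a Lie algebra of order F; in particular Σ_{j=1}^{F+1} [a_j, {a₁,…,a_{j-1},a_{j+1},…,a_{F+1}}] = 0 for all a₁,…,a_{F+1} ∈ A_i. -/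

import Mathlib

/-- The commutator `[x,y] = xy - yx` in an associative ring. -/
def ringComm {A : Type*} [Ring A] (x y : A) : A := x * y - y * x

/-- The full symmetrization `{Y₁,…,Y_F} = Σ_{σ ∈ S_F} Y_{σ(1)} ⋯ Y_{σ(F)}`. -/
noncomputable def symProd {A : Type*} [Ring A] (F : ℕ) (Y : Fin F → A) : A :=
  ∑ e : Equiv.Perm (Fin F), (List.ofFn fun j => Y (e j)).prod

/-- The inner derivation `[x, ·]` satisfies the Leibniz rule on ordered products. -/
theorem ringComm_prod_ofFn {A : Type*} [Ring A] (x : A) :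
    ∀ {n : ℕ} (f : Fin n → A), ringComm x (List.ofFn f).prod =
      ∑ j, (List.ofFn (Function.update f j (ringComm x (f j)))).prod
  | 0, f => by simp [ringComm]
  | n + 1, f => by
    have ih := ringComm_prod_ofFn x fun k : Fin n => f k.succ
    have h_zero (c : A) : (fun k : Fin n => Function.update f 0 c k.succ) = fun k => f k.succ := by
      ext k
      simp
    have h_succ (j : Fin n) (c : A) : (fun k : Fin n => Function.update f j.succ c k.succ) =
        Function.update (fun k => f k.succ) j c := by
      ext k
      simp [Function.update_apply]
    simp only [List.ofFn_succ, List.prod_cons, Fin.sum_univ_succ, Function.update_self, h_zero,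
      h_succ, Function.update_of_ne (Fin.succ_ne_zero _).symm, ← Finset.mul_sum, ← ih]
    simp only [ringComm]
    noncomm_ring

/-- The inner derivation `[x, ·]` satisfies the Leibniz rule on symmetrized products. -/
theorem ringComm_symProd {A : Type*} [Ring A] {n : ℕ} (x : A) (Y : Fin n → A) :
    ringComm x (symProd n Y) = ∑ j, symProd n (Function.update Y j (ringComm x (Y j))) := by
  have h_sum : ringComm x (symProd n Y) =
      ∑ e : Equiv.Perm (Fin n), ringComm x (List.ofFn fun j => Y (e j)).prod := by
    simp only [symProd, ringComm, Finset.mul_sum, Finset.sum_mul, Finset.sum_sub_distrib]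
  simp only [h_sum, ringComm_prod_ofFn]
  refine (Finset.sum_congr rfl fun e _ => Fintype.sum_equiv e _
    (fun j => (List.ofFn fun k => Function.update Y j (ringComm x (Y j)) (e k)).prod)
    fun j => ?_).trans Finset.sum_comm
  congr 2
  ext k
  simp [Function.update_apply]

/-- A permutation of `Fin (n + 1)` amounts to the image `j` of `0` and a permutation of the
remaining `n` indices, enumerated by `j.succAbove`. -/
theorem sum_perm_fin_succ {M : Type*} [AddCommMonoid M] {n : ℕ}
    (g : Fin (n + 1) → (Fin n → Fin (n + 1)) → M) :
    ∑ e : Equiv.Perm (Fin (n + 1)), g (e 0) (fun k => e k.succ) =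
      ∑ j, ∑ e : Equiv.Perm (Fin n), g j fun k => j.succAbove (e k) := by
  rw [← Equiv.sum_comp Equiv.Perm.decomposeFin.symm, Fintype.sum_prod_type]
  refine Finset.sum_congr rfl fun j _ => ?_
  simp only [Equiv.Perm.decomposeFin_symm_apply_zero, Equiv.Perm.decomposeFin_symm_apply_succ]
  cases j using Fin.cases with
  | zero => simp
  | succ i =>
    simp only [← Fin.succAbove_cycleRange]
    exact Equiv.sum_comp (Equiv.mulLeft i.cycleRange)
      fun e : Equiv.Perm (Fin n) => g i.succ fun k => i.succ.succAbove (e k)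

/-- Expansion of the symmetrized product along its first factor. -/
theorem symProd_succ {A : Type*} [Ring A] {n : ℕ} (Y : Fin (n + 1) → A) :
    symProd (n + 1) Y = ∑ j, Y j * symProd n fun k => Y (j.succAbove k) := by
  simp only [symProd, List.ofFn_succ, List.prod_cons, Finset.mul_sum]
  exact sum_perm_fin_succ fun j f => Y j * (List.ofFn fun k => Y (f k)).prod

/-- Expansion of the symmetrized product along its last factor. -/
theorem symProd_succ_last {A : Type*} [Ring A] {n : ℕ} (Y : Fin (n + 1) → A) :
    symProd (n + 1) Y = ∑ j, (symProd n fun k => Y (j.succAbove k)) * Y j := by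
  simp only [symProd, Finset.sum_mul]
  rw [← Equiv.sum_comp (Equiv.mulRight (finRotate (n + 1)))]
  simp only [Equiv.coe_mulRight, Equiv.Perm.mul_apply, List.ofFn_succ_last, List.prod_append,
    List.prod_singleton, finRotate_apply, Fin.coeSucc_eq_succ,
    Fin.last_add_one]
  exact sum_perm_fin_succ fun j f => (List.ofFn fun k => Y (f k)).prod * Y j


/-- In a `ℤ/F`-graded associative algebra, the commutator on `A₀`,
its action on `A_i`, and the fully symmetrized `F`-fold bracket on `A_i` satisfy
all four Jacobi identities of a Lie algebra of order `F`. -/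
theorem graded_assoc_gives_lie_order_F (F : ℕ) (hF : 1 ≤ F)
    {A : Type*} [Ring A] [Algebra ℂ A]
    (𝒜 : ZMod F → Submodule ℂ A)
    (hmul : ∀ a b (x y : A), x ∈ 𝒜 a → y ∈ 𝒜 b → x * y ∈ 𝒜 (a + b))
    (i : ZMod F) (hi : i ≠ 0) :
    (∀ x y z : A, x ∈ 𝒜 0 → y ∈ 𝒜 0 → z ∈ 𝒜 0 →
      ringComm (ringComm x y) z + ringComm (ringComm y z) x +
        ringComm (ringComm z x) y = 0) ∧
    (∀ x y w : A, x ∈ 𝒜 0 → y ∈ 𝒜 0 → w ∈ 𝒜 i →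
      ringComm (ringComm x y) w + ringComm (ringComm y w) x +
        ringComm (ringComm w x) y = 0) ∧
    (∀ (x : A), x ∈ 𝒜 0 → ∀ Y : Fin F → A, (∀ j, Y j ∈ 𝒜 i) →
      ringComm x (symProd F Y) =
        ∑ j : Fin F, symProd F (Function.update Y j (ringComm x (Y j)))) ∧
    (∀ Y : Fin (F + 1) → A, (∀ j, Y j ∈ 𝒜 i) →
      ∑ j : Fin (F + 1),
        ringComm (Y j) (symProd F fun k => Y (j.succAbove k)) = 0) := by
  refine ⟨fun x y z _ _ _ => ?_, fun x y w _ _ _ => ?_, fun x _ Y _ => ringComm_symProd x Y,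
    fun Y _ => ?_⟩
  · simp only [ringComm]
    noncomm_ring
  · simp only [ringComm]
    noncomm_ring
  · simp only [ringComm, Finset.sum_sub_distrib]
    rw [← symProd_succ, ← symProd_succ_last, sub_self]
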